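/- Let Ω ⊂ ℝ² be an open bounded connected domain of class C¹ such that the normal distance to the cut locus λ_Ω(y) is equal to the same constant for all y ∈ ∂Ω. Then H(Ω) = Cut(Ω). -/

import Mathlib

open Metric Set Real
open scoped RealInnerProductSpace Topology

noncomputable section

abbrev E2 := EuclideanSpace ℝ (Fin 2)

/-- The set of closest points to `x` on the boundary of `Ω`. -/
def projBd (Ω : Set E2) (x : E2) : Set E2 :=
  {y ∈ frontier Ω | dist x y = infDist x (frontier Ω)}

/-- The skeleton `Σ(Ω)`: points of `Ω` with more than one closest boundary point. -/
def skeleton (Ω : Set E2) : Set E2 :=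
  {x ∈ Ω | ∃ y ∈ projBd Ω x, ∃ z ∈ projBd Ω x, y ≠ z}

/-- The cut locus `Cut(Ω)`: the closure of the skeleton. -/
def cutLocus (Ω : Set E2) : Set E2 := closure (skeleton Ω)

/-- The high ridge `H(Ω)`: the set where `d_{∂Ω}` attains its maximum over `closure Ω`. -/
def highRidge (Ω : Set E2) : Set E2 :=
  {x ∈ closure Ω | ∀ z ∈ closure Ω, infDist z (frontier Ω) ≤ infDist x (frontier Ω)}

/-- A planar domain is of class `C^k` if near each boundary point, in suitable orthonormal
coordinates, its boundary is the graph of a `C^k` function and the domain is the region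
above the graph. -/
def IsCkDomain2 (k : ℕ∞) (Ω : Set E2) : Prop :=
  ∀ y ∈ frontier Ω, ∃ (e : E2 ≃ᵃⁱ[ℝ] E2) (U : Set E2) (g : ℝ → ℝ),
    IsOpen U ∧ y ∈ U ∧ ContDiff ℝ k g ∧
    (∀ z ∈ U, z ∈ Ω ↔ g (e z 0) < e z 1) ∧
    (∀ z ∈ U, z ∈ frontier Ω ↔ g (e z 0) = e z 1)

/-- `ν` is the inner unit normal to `∂Ω` at the boundary point `y`: it is a unit vector,
orthogonal to the tangent cone of `∂Ω` at `y`, and pointing into `Ω`. -/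
def IsInnerUnitNormal (Ω : Set E2) (y ν : E2) : Prop :=
  ‖ν‖ = 1 ∧ (∀ v ∈ tangentConeAt ℝ (frontier Ω) y, ⟪ν, v⟫ = 0) ∧
    ∀ᶠ t : ℝ in 𝓝[>] 0, y + t • ν ∈ Ω

/-- The normal distance to the cut locus of the boundary point `y` (with inner unit
normal `ν`): `λ_Ω(y) = sup {t ≥ 0 : π_{∂Ω}(y + t ν) = {y}}`. -/
def normalDist (Ω : Set E2) (y ν : E2) : ℝ :=
  sSup {t : ℝ | 0 ≤ t ∧ projBd Ω (y + t • ν) = {y}}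

theorem mem_projBd_iff {Ω : Set E2} {x y : E2} :
    y ∈ projBd Ω x ↔ y ∈ frontier Ω ∧ ∀ z ∈ frontier Ω, dist x y ≤ dist x z := by
  constructor
  · rintro ⟨hy, h⟩
    exact ⟨hy, fun z hz => h ▸ infDist_le_dist_of_mem hz⟩
  · rintro ⟨hy, h⟩
    exact ⟨hy, le_antisymm ((le_infDist ⟨y, hy⟩).2 fun z hz => h z hz) (infDist_le_dist_of_mem hy)⟩

theorem projBd_nonempty {Ω : Set E2} (hne : (frontier Ω).Nonempty) (x : E2) :
    (projBd Ω x).Nonempty := by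
  obtain ⟨y, hy, h⟩ := isClosed_frontier.exists_infDist_eq_dist hne x
  exact ⟨y, hy, h.symm⟩

/-- A ball that misses the boundary of `Ω` and meets `Ω` is contained in `Ω`. -/
theorem ball_subset_of_infDist {Ω : Set E2} {x p : E2} (hp : p ∈ Ω)
    (hpx : p ∈ ball x (infDist x (frontier Ω))) : ball x (infDist x (frontier Ω)) ⊆ Ω := by
  have hfr : ∀ q ∈ ball x (infDist x (frontier Ω)), q ∉ frontier Ω := by
    intro q hq hqf
    rw [mem_ball'] at hq
    exact hq.not_ge (infDist_le_dist_of_mem hqf)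
  have hint : ∀ q ∈ ball x (infDist x (frontier Ω)), q ∈ closure Ω → q ∈ interior Ω := by
    intro q hq hqc
    by_contra hqi
    exact hfr q hq ⟨hqc, hqi⟩
  intro q hq
  by_contra hqΩ
  obtain ⟨z, -, hz1, hz2⟩ := (convex_ball x (infDist x (frontier Ω))).isPreconnected
    (interior Ω) (closure Ω)ᶜ isOpen_interior isClosed_closure.isOpen_compl
    (fun w hw => (em (w ∈ closure Ω)).imp (hint w hw) id)
    ⟨p, hpx, hint p hpx (subset_closure hp)⟩
    ⟨q, hq, fun hqc => hqΩ (interior_subset (hint q hq hqc))⟩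
  exact hz2 (subset_closure (interior_subset hz1))

theorem infDist_frontier_pos {Ω : Set E2} (hop : IsOpen Ω) (hne : (frontier Ω).Nonempty) {x : E2}
    (hx : x ∈ Ω) : 0 < infDist x (frontier Ω) := by
  rw [← isClosed_frontier.notMem_iff_infDist_pos hne, hop.frontier_eq]
  exact fun h => h.2 hx

/-- If `y` is a closest boundary point of `y + t • ν`, then it is the only closest boundary point
of the previous points of the normal segment. -/
theorem projBd_eq_singleton_of_lt {Ω : Set E2} {y ν : E2} {s t : ℝ} (hν : ‖ν‖ = 1)
    (hs : 0 ≤ s) (hst : s < t) (hy : y ∈ projBd Ω (y + t • ν)) :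
    projBd Ω (y + s • ν) = {y} := by
  obtain ⟨hyf, hmin⟩ := mem_projBd_iff.1 hy
  have hd : ∀ (r : ℝ) (z : E2), dist (y + r • ν) z ^ 2 =
      ‖z - y‖ ^ 2 - 2 * r * ⟪z - y, ν⟫ + r ^ 2 := by
    intro r z
    rw [dist_eq_norm, norm_sub_rev, ← sub_sub, norm_sub_sq_real, norm_smul, hν, inner_smul_right,
      mul_one, Real.norm_eq_abs, sq_abs]
    ring
  have hlt : ∀ z ∈ frontier Ω, z ≠ y → dist (y + s • ν) y < dist (y + s • ν) z := by
    intro z hz hzy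
    have h1 : 0 < ‖z - y‖ ^ 2 := pow_pos (norm_pos_iff.2 (sub_ne_zero.2 hzy)) 2
    have h2 := pow_le_pow_left₀ dist_nonneg (hmin z hz) 2
    refine lt_of_pow_lt_pow_left₀ 2 dist_nonneg ?_
    rw [hd, hd] at *
    simp only [sub_self, norm_zero, inner_zero_left] at *
    rcases le_or_gt ⟪z - y, ν⟫ 0 with h | h <;> nlinarith
  ext z
  rw [mem_singleton_iff, mem_projBd_iff]
  constructor
  · rintro ⟨hz, h⟩
    by_contra hzy
    exact (hlt z hz hzy).not_ge (h y hyf)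
  · rintro rfl
    refine ⟨hyf, fun w hw => ?_⟩
    rcases eq_or_ne w z with rfl | hwz
    · exact le_rfl
    · exact (hlt w hw hwz).le

/-- If `y` is a closest boundary point of `x`, then `x - y` is orthogonal to the boundary. -/
theorem inner_sub_eq_zero_of_mem_projBd {Ω : Set E2} (hreg : IsCkDomain2 1 Ω) {x y : E2}
    (hy : y ∈ projBd Ω x) {v : E2} (hv : v ∈ tangentConeAt ℝ (frontier Ω) y) :
    ⟪x - y, v⟫ = 0 := by
  obtain ⟨hyf, hmin⟩ := mem_projBd_iff.1 hy
  obtain ⟨e, U, g, hU, hyU, hg, -, hfr⟩ := hreg y hyf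
  set F : E2 → ℝ := fun z => e z 1 - g (e z 0) with hF
  have hcoord : ∀ i : Fin 2, HasStrictFDerivAt (fun z => e z i)
      ((EuclideanSpace.proj i : E2 →L[ℝ] ℝ) ∘L
        (e.linearIsometryEquiv.toContinuousLinearEquiv : E2 →L[ℝ] E2)) y := by
    intro i
    have h : (fun z => e z i) = fun z => (((EuclideanSpace.proj i : E2 →L[ℝ] ℝ) ∘L
        (e.linearIsometryEquiv.toContinuousLinearEquiv : E2 →L[ℝ] E2)) z) + e 0 i := by
      funext z
      have := e.map_vadd 0 z
      simp only [vadd_eq_add, add_zero] at this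
      rw [this]
      simp
    rw [h]
    exact (ContinuousLinearMap.hasStrictFDerivAt _).add_const _
  have hg' : HasStrictDerivAt g (deriv g (e y 0)) (e y 0) :=
    hg.contDiffAt.hasStrictDerivAt (by norm_num)
  have hF' := (hcoord 1).sub (hg'.comp_hasStrictFDerivAt y (hcoord 0))
  have hφ' := (hasStrictFDerivAt_norm_sq (x - id y)).comp y ((hasStrictFDerivAt_id y).const_sub x)
  set F' := ((EuclideanSpace.proj 1 : E2 →L[ℝ] ℝ) ∘L
        (e.linearIsometryEquiv.toContinuousLinearEquiv : E2 →L[ℝ] E2)) -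
      deriv g (e y 0) • ((EuclideanSpace.proj 0 : E2 →L[ℝ] ℝ) ∘L
        (e.linearIsometryEquiv.toContinuousLinearEquiv : E2 →L[ℝ] E2)) with hF'def
  have hFy : F y = 0 := by
    have := (hfr y hyU).1 hyf
    simp only [hF]
    linarith
  have hext : IsLocalExtrOn (fun z => ‖x - id z‖ ^ 2) {z | F z = F y} y := by
    refine Or.inl ?_
    filter_upwards [self_mem_nhdsWithin, mem_nhdsWithin_of_mem_nhds (hU.mem_nhds hyU)] with z hz hzU
    have hzf : z ∈ frontier Ω := (hfr z hzU).2 (by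
      have : F z = 0 := Eq.trans hz hFy
      simp only [hF] at this
      linarith)
    have := hmin z hzf
    rw [dist_eq_norm, dist_eq_norm] at this
    simp only [id]
    gcongr
  obtain ⟨a, b, hab, hsum⟩ := hext.exists_multipliers_of_hasStrictFDerivAt_1d hF' hφ'
  have hFv : F' v = 0 := by
    have h1 : HasFDerivWithinAt F F' (frontier Ω) y := hF'.hasFDerivAt.hasFDerivWithinAt
    have h2 : HasFDerivWithinAt F (0 : E2 →L[ℝ] ℝ) (frontier Ω) y := by
      refine (hasFDerivWithinAt_const (0 : ℝ) y (frontier Ω)).congr_of_eventuallyEq ?_ hFy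
      filter_upwards [self_mem_nhdsWithin, mem_nhdsWithin_of_mem_nhds (hU.mem_nhds hyU)]
        with z hz hzU
      have := (hfr z hzU).1 hz
      simp only [hF]
      linarith
    simpa using h1.unique_on h2 hv
  have hb : b ≠ 0 := by
    rintro rfl
    have ha : a ≠ 0 := fun h => hab (by simp [h])
    have h0 := DFunLike.congr_fun hsum
      (e.linearIsometryEquiv.symm (EuclideanSpace.single (1 : Fin 2) (1 : ℝ)))
    simp [hF'def, ha] at h0
  have hv0 := DFunLike.congr_fun hsum v
  simpa [hFv, hb, inner_sub_left] using hv0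

/-- The unit direction from a closest boundary point of an interior point is an inner normal. -/
theorem exists_isInnerUnitNormal {Ω : Set E2} (hop : IsOpen Ω) (hreg : IsCkDomain2 1 Ω)
    {x y : E2} (hx : x ∈ Ω) (hy : y ∈ projBd Ω x) :
    ∃ ν, IsInnerUnitNormal Ω y ν ∧ x = y + infDist x (frontier Ω) • ν := by
  have hr := infDist_frontier_pos hop ⟨y, hy.1⟩ hx
  set r := infDist x (frontier Ω) with hrdef
  have hn : ‖x - y‖ = r := by rw [← dist_eq_norm]; exact hy.2
  have hxe : x = y + r • (r⁻¹ • (x - y)) := by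
    rw [smul_inv_smul₀ hr.ne']; abel
  have hν : ‖r⁻¹ • (x - y)‖ = 1 := by
    rw [norm_smul, hn, norm_inv, Real.norm_of_nonneg hr.le, inv_mul_cancel₀ hr.ne']
  refine ⟨r⁻¹ • (x - y), ⟨hν, fun v hv => ?_, ?_⟩, hxe⟩
  · rw [real_inner_smul_left, inner_sub_eq_zero_of_mem_projBd hreg hy hv, mul_zero]
  · filter_upwards [Ioo_mem_nhdsGT hr] with t ht
    refine ball_subset_of_infDist hx (mem_ball_self hr) ?_
    rw [← hrdef, mem_ball, dist_eq_norm]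
    nth_rw 2 [hxe]
    rw [add_sub_add_left_eq_sub, ← sub_smul, norm_smul, hν, mul_one, Real.norm_eq_abs, abs_lt]
    constructor <;> linarith [ht.1, ht.2]

theorem le_normalDist {Ω : Set E2} (hbd : Bornology.IsBounded Ω) {y ν : E2} {t : ℝ}
    (hν : IsInnerUnitNormal Ω y ν) (hy : y ∈ projBd Ω (y + t • ν)) :
    t ≤ normalDist Ω y ν := by
  have hbdd : BddAbove {t : ℝ | 0 ≤ t ∧ projBd Ω (y + t • ν) = {y}} := by
    refine ⟨diam (closure Ω), ?_⟩
    rintro s ⟨hs, hproj⟩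
    rcases hs.eq_or_lt with rfl | hs
    · exact diam_nonneg
    have hys : y ∈ projBd Ω (y + s • ν) := hproj ▸ rfl
    have hd : dist (y + s • ν) y = s := by
      rw [dist_eq_norm, add_sub_cancel_left, norm_smul, hν.1, mul_one, Real.norm_of_nonneg hs.le]
    obtain ⟨u, hu, hus⟩ := (hν.2.2.and (Ioo_mem_nhdsGT hs)).exists
    have hpos : infDist (y + s • ν) (frontier Ω) = s := hys.2 ▸ hd
    have hsub := ball_subset_of_infDist (x := y + s • ν) hu (by
      rw [hpos, mem_ball, dist_eq_norm, add_sub_add_left_eq_sub, ← sub_smul, norm_smul, hν.1,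
        mul_one, Real.norm_eq_abs, abs_lt]
      constructor <;> linarith [hus.1, hus.2])
    have hmem : y + s • ν ∈ Ω := hsub (mem_ball_self (by rwa [hpos]))
    rw [← hd]
    exact dist_le_diam_of_mem hbd.closure (subset_closure hmem) (frontier_subset_closure hys.1)
  refine le_of_forall_lt_imp_le_of_dense fun s hst => ?_
  rcases lt_or_ge s 0 with hs | hs
  · exact hs.le.trans (Real.sSup_nonneg fun _ h => h.1)
  · exact le_csSup hbdd ⟨hs, projBd_eq_singleton_of_lt hν.1 hs hst hy⟩

/-- A point of maximal distance from the boundary has at least two closest boundary points. -/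
theorem highRidge_subset_skeleton {Ω : Set E2} (hop : IsOpen Ω) (hbd : Bornology.IsBounded Ω)
    (hne : Ω.Nonempty) (hfne : (frontier Ω).Nonempty) : highRidge Ω ⊆ skeleton Ω := by
  rintro x ⟨hxc, hmax⟩
  obtain ⟨p, hp⟩ := hne
  set r := infDist x (frontier Ω) with hr
  have hr0 : 0 < r :=
    (infDist_frontier_pos hop hfne hp).trans_le (hmax p (subset_closure hp))
  have hxΩ : x ∈ Ω := by
    have h : x ∉ frontier Ω := (isClosed_frontier.notMem_iff_infDist_pos hfne).2 hr0
    rw [hop.frontier_eq] at h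
    by_contra hx
    exact h ⟨hxc, hx⟩
  refine ⟨hxΩ, ?_⟩
  by_contra! huniq
  obtain ⟨y, hy⟩ := projBd_nonempty hfne x
  have hn : ‖x - y‖ = r := by rw [← dist_eq_norm]; exact hy.2
  -- the boundary points that do not lie on the same side of `x` as `y`
  set K : Set E2 := frontier Ω ∩ {z | ⟪x - y, x - z⟫ ≤ 0} with hK
  have hKc : IsCompact K := by
    refine (isCompact_of_isClosed_isBounded isClosed_frontier
      (hbd.closure.subset frontier_subset_closure)).inter_right ?_
    exact isClosed_le (by fun_prop) continuous_const
  obtain ⟨δ, hδ, hKδ⟩ : ∃ δ > 0, ∀ z ∈ K, r + δ ≤ dist x z := by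
    rcases K.eq_empty_or_nonempty with h | h
    · exact ⟨1, one_pos, by simp [h]⟩
    obtain ⟨w, hw, hwmin⟩ := hKc.exists_isMinOn h (f := fun z => dist x z) (by fun_prop)
    refine ⟨dist x w - r, ?_, fun z hz => ?_⟩
    · have hle : r ≤ dist x w := infDist_le_dist_of_mem hw.1
      refine sub_pos.2 (lt_of_le_of_ne hle fun heq => ?_)
      have hyw := huniq y hy w ⟨hw.1, heq.symm⟩
      have h2 : ⟪x - y, x - w⟫ ≤ 0 := hw.2
      rw [← hyw, real_inner_self_eq_norm_sq, hn] at h2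
      nlinarith
    · have := hwmin hz
      simp only [mem_ofPred_eq] at this
      linarith
  set h : ℝ := min (1 / 2) (δ / (2 * r)) with hh
  have hh0 : 0 < h := lt_min (by norm_num) (by positivity)
  have hh1 : h ≤ 1 / 2 := min_le_left _ _
  have hh2 : h * r ≤ δ / 2 := by
    calc h * r ≤ δ / (2 * r) * r := by gcongr; exact min_le_right _ _
      _ = δ / 2 := by field_simp
  have hdq : dist (x + h • (x - y)) x = h * r := by
    rw [dist_eq_norm, add_sub_cancel_left, norm_smul, hn, Real.norm_of_nonneg hh0.le]
  have hqΩ : x + h • (x - y) ∈ Ω :=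
    ball_subset_of_infDist hxΩ (mem_ball_self hr0) (by
      rw [← hr, mem_ball, hdq]; nlinarith)
  obtain ⟨z, hz⟩ := projBd_nonempty hfne (x + h • (x - y))
  have hle : dist (x + h • (x - y)) z ≤ r := hz.2 ▸ hmax _ (subset_closure hqΩ)
  have hrz : r ≤ dist x z := infDist_le_dist_of_mem hz.1
  by_cases hzK : z ∈ K
  · have h1 := hKδ z hzK
    have h2 := dist_triangle x (x + h • (x - y)) z
    rw [dist_comm x (x + _), hdq] at h2
    linarith
  · have h1 : 0 < ⟪x - y, x - z⟫ := by
      by_contra hc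
      exact hzK ⟨hz.1, not_lt.1 hc⟩
    have h2 : dist (x + h • (x - y)) z ^ 2 =
        dist x z ^ 2 + 2 * (h * ⟪x - y, x - z⟫) + (h * r) ^ 2 := by
      rw [dist_eq_norm, dist_eq_norm, add_sub_right_comm, norm_add_sq_real, norm_smul, hn,
        inner_smul_right, Real.norm_of_nonneg hh0.le, real_inner_comm]
    have h3 : 0 < h * ⟪x - y, x - z⟫ := mul_pos hh0 h1
    have h4 : dist (x + h • (x - y)) z ^ 2 ≤ r ^ 2 := pow_le_pow_left₀ dist_nonneg hle 2
    have h5 : r ^ 2 ≤ dist x z ^ 2 := pow_le_pow_left₀ hr0.le hrz 2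
    nlinarith [sq_nonneg (h * r)]

theorem isClosed_highRidge (Ω : Set E2) : IsClosed (highRidge Ω) := by
  have h : highRidge Ω = closure Ω ∩
      ⋂ z ∈ closure Ω, {x | infDist z (frontier Ω) ≤ infDist x (frontier Ω)} := by
    ext x
    simp [highRidge]
  rw [h]
  exact isClosed_closure.inter (isClosed_biInter fun z _ =>
    isClosed_le continuous_const (continuous_infDist_pt _))

/-- **Corollary.** Let `Ω ⊂ ℝ²` be an open bounded connected domain of class `C¹` whose
normal distance to the cut locus `λ_Ω` is constant along `∂Ω`. Then the high ridge and
the cut locus of `Ω` coincide. -/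
theorem stmt7 (Ω : Set E2) (hop : IsOpen Ω)
    (hbd : Bornology.IsBounded Ω) (hconn : IsConnected Ω)
    (hreg : IsCkDomain2 1 Ω) (c : ℝ)
    (hlam : ∀ y ∈ frontier Ω, ∀ ν : E2, IsInnerUnitNormal Ω y ν →
      normalDist Ω y ν = c) :
    highRidge Ω = cutLocus Ω := by
  have hfne : (frontier Ω).Nonempty := by
    refine nonempty_frontier_iff.2 ⟨hconn.nonempty, fun h => ?_⟩
    rw [h] at hbd
    exact NormedSpace.unbounded_univ ℝ E2 hbd
  refine Subset.antisymm
    ((highRidge_subset_skeleton hop hbd hconn.nonempty hfne).trans subset_closure)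
    (closure_minimal ?_ (isClosed_highRidge Ω))
  rintro x ⟨hx, y, hy, z, hz, hyz⟩
  refine ⟨subset_closure hx, ?_⟩
  obtain ⟨x₀, hx₀, hmax⟩ := hbd.isCompact_closure.exists_isMaxOn hconn.nonempty.closure
    (continuous_infDist_pt (frontier Ω)).continuousOn
  have hx₀Ω := (highRidge_subset_skeleton hop hbd hconn.nonempty hfne ⟨hx₀, hmax⟩).1
  obtain ⟨y₀, hy₀⟩ := projBd_nonempty hfne x₀
  obtain ⟨ν₀, hν₀, hxe₀⟩ := exists_isInnerUnitNormal hop hreg hx₀Ω hy₀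
  have hc : infDist x₀ (frontier Ω) ≤ c := by
    rw [← hlam y₀ hy₀.1 ν₀ hν₀]
    exact le_normalDist hbd hν₀ (hxe₀ ▸ hy₀)
  obtain ⟨ν, hν, hxe⟩ := exists_isInnerUnitNormal hop hreg hx hy
  have hcx : c ≤ infDist x (frontier Ω) := by
    by_contra! hlt
    rw [← hlam y hy.1 ν hν] at hlt
    have hmem0 : (0 : ℝ) ∈ {t : ℝ | 0 ≤ t ∧ projBd Ω (y + t • ν) = {y}} :=
      ⟨le_rfl, projBd_eq_singleton_of_lt hν.1 le_rfl (infDist_frontier_pos hop hfne hx)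
        (hxe ▸ hy)⟩
    obtain ⟨t, ⟨-, ht⟩, hlt'⟩ := exists_lt_of_lt_csSup ⟨0, hmem0⟩ hlt
    have hs := projBd_eq_singleton_of_lt hν.1 infDist_nonneg hlt' (ht.symm ▸ mem_singleton y)
    rw [← hxe] at hs
    rw [hs] at hz
    exact hyz hz.symm
  exact fun w hw => (hmax hw).trans (hc.trans hcx)
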